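/- arXiv:1712.00140 — 3 statements merged into one kernel-verified Lean document; each statement's English description precedes it below -/
import Mathlib

section
/- The integrals I(t) = ∫₀¹ √( x(1 − x)/(x + t)³ ) dx tend to +∞ as t → 0 through positive real values; that is, the function t ↦ I(t) tends to infinity along the filter of positive reals approaching 0. -/
open MeasureTheory

lemma aux_bound (t : ℝ) (ht : 0 < t) (ht2 : t < 1 / 2) :
    (1 / 4) * Real.log ((1 / 2) / t) ≤
      ∫ x in (0:ℝ)..1, Real.sqrt (x * (1 - x) / (x + t) ^ 3) := by
  have hc : ContinuousOn (fun x : ℝ => Real.sqrt (x * (1 - x) / (x + t) ^ 3)) (Set.Icc 0 1) := by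
    apply Real.continuous_sqrt.comp_continuousOn
    apply ContinuousOn.div (by fun_prop) (by fun_prop)
    intro x hx
    have : 0 < x + t := by linarith [hx.1]
    positivity
  have hint : IntervalIntegrable (fun x : ℝ => Real.sqrt (x * (1 - x) / (x + t) ^ 3))
      volume 0 1 := by
    apply ContinuousOn.intervalIntegrable
    rwa [Set.uIcc_of_le zero_le_one]
  have h1 : ∫ x in t..(1 / 2), Real.sqrt (x * (1 - x) / (x + t) ^ 3) ≤
      ∫ x in (0:ℝ)..1, Real.sqrt (x * (1 - x) / (x + t) ^ 3) := by
    apply intervalIntegral.integral_mono_interval ht.le ht2.le (by norm_num) _ hint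
    exact Filter.Eventually.of_forall fun x => Real.sqrt_nonneg _
  refine le_trans ?_ h1
  rw [← integral_inv_of_pos ht (by norm_num), ← intervalIntegral.integral_const_mul]
  apply intervalIntegral.integral_mono_on ht2.le
  · apply ContinuousOn.intervalIntegrable
    rw [Set.uIcc_of_le ht2.le]
    apply ContinuousOn.mul continuousOn_const
    apply ContinuousOn.inv₀ continuousOn_id
    intro x hx
    exact (lt_of_lt_of_le ht hx.1).ne'
  · apply ContinuousOn.intervalIntegrable
    rw [Set.uIcc_of_le ht2.le]
    exact hc.mono (Set.Icc_subset_Icc ht.le (by norm_num))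
  · intro x hx
    have hx0 : 0 < x := lt_of_lt_of_le ht hx.1
    apply Real.le_sqrt_of_sq_le
    have h3 : (x + t) ^ 3 ≤ (2 * x) ^ 3 := by
      apply pow_le_pow_left₀ (by positivity)
      linarith [hx.1]
    calc (1 / 4 * x⁻¹) ^ 2 = (x * (1 / 2)) / (2 * x) ^ 3 := by field_simp; norm_num
      _ ≤ x * (1 - x) / (x + t) ^ 3 := by
        have h5 : 1 / 2 ≤ 1 - x := by linarith [hx.2]
        have h6 : 0 ≤ x * (1 - x) := mul_nonneg hx0.le (by linarith)
        exact div_le_div₀ h6 (mul_le_mul_of_nonneg_left h5 hx0.le) (by positivity) h3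

/-- Section 5 example: the integrals
`I(t) = ∫₀¹ √(x(1−x)/(x+t)³) dx` tend to `+∞` as `t → 0⁺`; i.e. the derivative of the period
of the vertical saddle connection `[0,1]` of `z(z−1)/(z+t) dz²` blows up as the zero collides
with the simple pole. -/
theorem stmt11 :
    Filter.Tendsto (fun t : ℝ => ∫ x in (0:ℝ)..1, Real.sqrt (x * (1 - x) / (x + t) ^ 3))
      (nhdsWithin 0 (Set.Ioi 0)) Filter.atTop := by
  have hlim : Filter.Tendsto (fun t : ℝ => (1 / 4) * Real.log ((1 / 2) / t))
      (nhdsWithin 0 (Set.Ioi 0)) Filter.atTop := by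
    apply Filter.Tendsto.const_mul_atTop (by norm_num)
    apply Real.tendsto_log_atTop.comp
    simp only [div_eq_mul_inv]
    exact Filter.Tendsto.const_mul_atTop (by norm_num) tendsto_inv_nhdsGT_zero
  refine Filter.tendsto_atTop_mono' _ ?_ hlim
  filter_upwards [Ioo_mem_nhdsGT (show (0:ℝ) < 1 / 2 by norm_num)] with t ht
  exact aux_bound t ht.1 ht.2
end

section
/- Let C ≥ 1, ε ≥ 0 and b > 0. Let g₁, g₂ : (0, b] → ℝ be continuous functions with 1/C ≤ g_i(t) ≤ C for all t and i = 1, 2, and suppose g₁(t) ≤ e^ε·g₂(t) and g₂(t) ≤ e^ε·g₁(t) for all t ∈ (0, b]. If c, c' ∈ (0, b] satisfy ∫₀^c t^{−1/2} g₁(t) dt = ∫₀^{c'} t^{−1/2} g₂(t) dt, then |log(c'/c)| ≤ 2C²·ε. -/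
open MeasureTheory

theorem aux_int (C b : ℝ) (g : ℝ → ℝ) (hC : 1 ≤ C)
    (hcont : ContinuousOn g (Set.Ioc (0:ℝ) b))
    (hg : ∀ t ∈ Set.Ioc (0:ℝ) b, 1 / C ≤ g t ∧ g t ≤ C) (hb : 0 < b) :
    IntervalIntegrable (fun t => t ^ (-(1:ℝ)/2) * g t) volume 0 b := by
  have h0 : IntervalIntegrable (fun t : ℝ => t ^ (-(1:ℝ)/2)) volume 0 b :=
    intervalIntegral.intervalIntegrable_rpow' (by norm_num)
  rw [intervalIntegrable_iff_integrableOn_Ioc_of_le hb.le] at h0 ⊢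
  refine Integrable.mul_bdd (c := C) h0 (hcont.aestronglyMeasurable measurableSet_Ioc) ?_
  refine (ae_restrict_iff' measurableSet_Ioc).2 (Filter.Eventually.of_forall fun t ht => ?_)
  have h1 : 0 < 1 / C := by positivity
  rw [Real.norm_eq_abs, abs_of_nonneg (h1.le.trans (hg t ht).1)]
  exact (hg t ht).2

theorem aux_val (x y : ℝ) : ∫ t in x..y, t ^ (-(1:ℝ)/2) = 2 * (√y - √x) := by
  rw [integral_rpow (Or.inl (by norm_num)), Real.sqrt_eq_rpow, Real.sqrt_eq_rpow]
  norm_num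
  ring

theorem aux_key (C ε b : ℝ) (hC : 1 ≤ C) (hε : 0 ≤ ε) (hb : 0 < b)
    (f g : ℝ → ℝ)
    (hcont1 : ContinuousOn f (Set.Ioc (0:ℝ) b)) (hcont2 : ContinuousOn g (Set.Ioc (0:ℝ) b))
    (hb1 : ∀ t ∈ Set.Ioc (0:ℝ) b, 1 / C ≤ f t ∧ f t ≤ C)
    (hb2 : ∀ t ∈ Set.Ioc (0:ℝ) b, 1 / C ≤ g t ∧ g t ≤ C)
    (hcomp : ∀ t ∈ Set.Ioc (0:ℝ) b, f t ≤ Real.exp ε * g t)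
    (c c' : ℝ) (hc : c ∈ Set.Ioc (0:ℝ) b) (hc' : c' ∈ Set.Ioc (0:ℝ) b)
    (hcc : c ≤ c')
    (heq : ∫ t in (0:ℝ)..c, t ^ (-(1:ℝ)/2) * f t =
      ∫ t in (0:ℝ)..c', t ^ (-(1:ℝ)/2) * g t) :
    Real.log (c' / c) ≤ 2 * C ^ 2 * ε := by
  have hC0 : 0 < C := by linarith
  have hfi := aux_int C b f hC hcont1 hb1 hb
  have hgi := aux_int C b g hC hcont2 hb2 hb
  have hri : ∀ x y : ℝ, IntervalIntegrable (fun t : ℝ => t ^ (-(1:ℝ)/2)) volume x y :=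
    fun x y => intervalIntegral.intervalIntegrable_rpow' (by norm_num)
  have sub : ∀ x y : ℝ, 0 ≤ x → x ≤ y → y ≤ b → Set.uIcc x y ⊆ Set.uIcc 0 b := by
    intro x y hx hxy hy
    rw [Set.uIcc_of_le hxy, Set.uIcc_of_le hb.le]
    exact Set.Icc_subset_Icc hx hy
  have hf0 := hfi.mono_set (sub 0 c le_rfl hc.1.le hc.2)
  have hg0 := hgi.mono_set (sub 0 c le_rfl hc.1.le hc.2)
  have hg1 := hgi.mono_set (sub c c' hc.1.le hcc hc'.2)
  have hp : ∀ t : ℝ, 0 < t → 0 ≤ t ^ (-(1:ℝ)/2) := fun t ht => Real.rpow_nonneg ht.le _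
  have e1 : ∫ t in (0:ℝ)..c, t ^ (-(1:ℝ)/2) * f t ≤
      Real.exp ε * ∫ t in (0:ℝ)..c, t ^ (-(1:ℝ)/2) * g t := by
    rw [← intervalIntegral.integral_const_mul]
    refine intervalIntegral.integral_mono_on_of_le_Ioo hc.1.le hf0 (hg0.const_mul _) ?_
    intro t ht
    have := mul_le_mul_of_nonneg_left (hcomp t ⟨ht.1, ht.2.le.trans hc.2⟩) (hp t ht.1)
    linarith
  have e2 : ∫ t in (0:ℝ)..c, t ^ (-(1:ℝ)/2) * g t ≤ 2 * (√c - √0) * C := by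
    rw [← aux_val, ← intervalIntegral.integral_mul_const]
    refine intervalIntegral.integral_mono_on_of_le_Ioo hc.1.le hg0 ((hri _ _).mul_const _) ?_
    intro t ht
    exact mul_le_mul_of_nonneg_left (hb2 t ⟨ht.1, ht.2.le.trans hc.2⟩).2 (hp t ht.1)
  have e3 : 2 * (√c' - √c) * (1 / C) ≤ ∫ t in c..c', t ^ (-(1:ℝ)/2) * g t := by
    rw [← aux_val, ← intervalIntegral.integral_mul_const]
    refine intervalIntegral.integral_mono_on_of_le_Ioo hcc ((hri _ _).mul_const _) hg1 ?_
    intro t ht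
    have h0 := hc.1.trans ht.1
    exact mul_le_mul_of_nonneg_left (hb2 t ⟨h0, ht.2.le.trans hc'.2⟩).1 (hp t h0)
  have e4 := intervalIntegral.integral_add_adjacent_intervals hg0 hg1
  rw [Real.sqrt_zero, sub_zero] at e2
  have hx : 0 ≤ Real.exp ε - 1 := by linarith [Real.one_le_exp hε]
  have e5 : 2 * (√c' - √c) * (1 / C) ≤ (Real.exp ε - 1) * (2 * √c * C) := by
    have := mul_le_mul_of_nonneg_left e2 hx
    linarith
  have e6 : √c' ≤ (1 + C ^ 2 * (Real.exp ε - 1)) * √c := by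
    rw [mul_one_div, div_le_iff₀ hC0] at e5
    linarith
  have e7 : 1 + C ^ 2 * (Real.exp ε - 1) ≤ Real.exp (C ^ 2 * ε) := by
    have := one_add_mul_self_le_rpow_one_add (s := Real.exp ε - 1) (by linarith)
      (p := C ^ 2) (by nlinarith)
    rwa [add_sub_cancel, ← Real.exp_mul, mul_comm ε] at this
  have hs : 0 < √c := Real.sqrt_pos.2 hc.1
  have hs' : 0 < √c' := Real.sqrt_pos.2 hc'.1
  have e8 : √c' ≤ Real.exp (C ^ 2 * ε) * √c :=
    e6.trans (mul_le_mul_of_nonneg_right e7 hs.le)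
  have e9 := Real.log_le_log hs' e8
  rw [Real.log_mul (Real.exp_ne_zero _) hs.ne', Real.log_exp, Real.log_sqrt hc'.1.le,
    Real.log_sqrt hc.1.le] at e9
  rw [Real.log_div hc'.1.ne' hc.1.ne']
  linarith

/-- the Claim `|log(h(c)/c)| ≤ Cε` in the quasisymmetry Lemma of Section 6:
if `g₁, g₂` are continuous on `(0,b]`, pinched between `1/C` and `C`, and agree within a factor
`e^ε`, and if `∫₀^c t^{-1/2} g₁ = ∫₀^{c'} t^{-1/2} g₂`, then `|log(c'/c)| ≤ 2C²ε`. -/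
theorem stmt13 (C ε b : ℝ) (hC : 1 ≤ C) (hε : 0 ≤ ε) (hb : 0 < b)
    (g₁ g₂ : ℝ → ℝ)
    (hcont1 : ContinuousOn g₁ (Set.Ioc (0:ℝ) b)) (hcont2 : ContinuousOn g₂ (Set.Ioc (0:ℝ) b))
    (hb1 : ∀ t ∈ Set.Ioc (0:ℝ) b, 1 / C ≤ g₁ t ∧ g₁ t ≤ C)
    (hb2 : ∀ t ∈ Set.Ioc (0:ℝ) b, 1 / C ≤ g₂ t ∧ g₂ t ≤ C)
    (hcomp : ∀ t ∈ Set.Ioc (0:ℝ) b,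
      g₁ t ≤ Real.exp ε * g₂ t ∧ g₂ t ≤ Real.exp ε * g₁ t)
    (c c' : ℝ) (hc : c ∈ Set.Ioc (0:ℝ) b) (hc' : c' ∈ Set.Ioc (0:ℝ) b)
    (heq : ∫ t in (0:ℝ)..c, t ^ (-(1:ℝ)/2) * g₁ t =
      ∫ t in (0:ℝ)..c', t ^ (-(1:ℝ)/2) * g₂ t) :
    |Real.log (c' / c)| ≤ 2 * C ^ 2 * ε := by
  rcases le_total c c' with h | h
  · rw [abs_of_nonneg (Real.log_nonneg ((one_le_div hc.1).2 h))]
    exact aux_key C ε b hC hε hb g₁ g₂ hcont1 hcont2 hb1 hb2 (fun t ht => (hcomp t ht).1)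
      c c' hc hc' h heq
  · rw [← abs_neg, ← Real.log_inv, inv_div,
      abs_of_nonneg (Real.log_nonneg ((one_le_div hc'.1).2 h))]
    exact aux_key C ε b hC hε hb g₂ g₁ hcont2 hcont1 hb2 hb1 (fun t ht => (hcomp t ht).2)
      c' c hc' hc h heq.symm
end

section
/- Let V be a real vector space, let ι be a nonempty index type, and let p : ι → Seminorm(ℝ, V) be a family of seminorms. Let S = convexHull ℝ ( ⋃_i { x ∈ V : p_i(x) ≤ 1 } ) and let N(x) = gauge(S)(x) be the Minkowski gauge of S. Then: (i) N(x) ≤ p_i(x) for every i ∈ ι and every x ∈ V; and (ii) for every seminorm q on V such that q(x) ≤ p_i(x) for all i ∈ ι and x ∈ V, one has q(x) ≤ N(x) for all x ∈ V. That is, the gauge of the convex hull of the union of the unit balls is the largest seminorm dominated by every p_i. -/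
open scoped Pointwise in
/-- the 'union convex hull operation' of Section 3.2: given a nonempty
family of seminorms `p i` on a real vector space `V`, the Minkowski gauge of the convex hull
of the union of their unit balls is the largest seminorm dominated by every `p i`. -/
theorem stmt17 {V : Type*} [AddCommGroup V] [Module ℝ V] {ι : Type*} [Nonempty ι]
    (p : ι → Seminorm ℝ V) :
    (∀ (i : ι) (x : V),
        gauge (convexHull ℝ (⋃ i : ι, {x : V | p i x ≤ 1})) x ≤ p i x) ∧
      (∀ q : Seminorm ℝ V, (∀ (i : ι) (x : V), q x ≤ p i x) →
        ∀ x : V, q x ≤ gauge (convexHull ℝ (⋃ i : ι, {x : V | p i x ≤ 1})) x) := by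
  have key : ∀ (i : ι) (x : V) (r : ℝ), 0 < r → p i x ≤ r →
      x ∈ r • (convexHull ℝ (⋃ i : ι, {x : V | p i x ≤ 1})) := by
    intro i x r hr hx
    rw [Set.mem_smul_set_iff_inv_smul_mem₀ hr.ne']
    apply subset_convexHull
    refine Set.mem_iUnion.2 ⟨i, ?_⟩
    change p i (r⁻¹ • x) ≤ 1
    rw [map_smul_eq_mul, Real.norm_of_nonneg (inv_pos.2 hr).le, inv_mul_le_iff₀ hr]
    simpa using hx
  constructor
  · intro i x
    refine le_of_forall_pos_le_add fun ε hε => ?_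
    have h0 : 0 ≤ p i x := apply_nonneg _ _
    have hr : 0 < p i x + ε := by linarith
    exact gauge_le_of_mem hr.le (key i x _ hr (by linarith))
  · intro q hq x
    have hsub : convexHull ℝ (⋃ i : ι, {x : V | p i x ≤ 1}) ⊆ q.closedBall 0 1 := by
      refine convexHull_min ?_ (q.convex_closedBall 0 1)
      refine Set.iUnion_subset fun i y hy => ?_
      rw [Seminorm.mem_closedBall_zero]
      exact (hq i y).trans hy
    obtain ⟨i⟩ := ‹Nonempty ι›
    have h0 : 0 ≤ p i x := apply_nonneg _ _
    rw [gauge_def]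
    refine le_csInf ⟨p i x + 1, ?_, key i x _ (by linarith) (by linarith)⟩ ?_
    · exact Set.mem_Ioi.2 (by linarith)
    · rintro r ⟨hr, y, hy, rfl⟩
      have hr' : 0 < r := hr
      have h1 := hsub hy
      rw [Seminorm.mem_closedBall_zero] at h1
      change q (r • y) ≤ r
      rw [map_smul_eq_mul, Real.norm_of_nonneg hr'.le]
      nlinarith
end
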